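/- arXiv:2212.07241 — 5 statements merged into one kernel-verified Lean document; each statement's English description precedes it below -/
import Mathlib

section
/- Let T be a nondegenerate triangle in the Euclidean plane ℝ² with minimum interior angle θ_m and maximum interior angle θ_M. Let e be a side of T with endpoints x₁ and x₂, let θ_e be the interior angle of T opposite to e, and suppose θ_e ≤ (1+ε)·θ_m for some real ε ≥ 0. Then for every affine function w : ℝ² → ℝ with (constant) gradient ∇w, one has |w(x₂) − w(x₁)| ≤ κ · √(area T) · ‖∇w‖, where κ = √2 / sin((π − θ_M)/(2 + ε)). -/
open MeasureTheory EuclideanGeometry Real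
open scoped RealInnerProductSpace

theorem aux_sin_le {x y : ℝ} (h0 : 0 ≤ x) (h1 : x ≤ y) (h2 : x ≤ π - y) : sin x ≤ sin y := by
  rcases le_total y (π / 2) with h | h
  · exact sin_le_sin_of_le_of_le_pi_div_two (by linarith [pi_pos]) h h1
  · rw [← sin_pi_sub y]
    exact sin_le_sin_of_le_of_le_pi_div_two (by linarith [pi_pos]) (by linarith) h2

theorem aux_trig0 (α β γ ε : ℝ) (hα : 0 < α) (hβ : 0 < β) (hγ : 0 < γ) (hs : α + β + γ = π)
    (hε : 0 ≤ ε) (h : α ≤ (1 + ε) * min α (min β γ)) (hle : β ≤ γ) :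
    0 < sin ((π - max α (max β γ)) / (2 + ε)) ∧
    sin α * sin ((π - max α (max β γ)) / (2 + ε)) ^ 2 ≤ sin β * sin γ := by
  rw [min_eq_left hle] at h
  rw [max_eq_right hle]
  have h2 : 0 < 2 + ε := by linarith
  have sa : 0 < sin α := sin_pos_of_pos_of_lt_pi hα (by linarith)
  have hab : α ≤ (1 + ε) * β := h.trans (by gcongr; exact min_le_right _ _)
  have hM : 0 < π - max α γ := by
    rcases max_choice α γ with h | h <;> rw [h] <;> linarith
  have hφ0 : 0 < (π - max α γ) / (2 + ε) := by positivity
  have hφβ : (π - max α γ) / (2 + ε) ≤ β := by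
    rw [div_le_iff₀ h2]
    rcases le_total α γ with h | h
    · rw [max_eq_right h]; nlinarith
    · rw [max_eq_left h]; nlinarith
  set φ := (π - max α γ) / (2 + ε)
  have sφ : 0 < sin φ := sin_pos_of_pos_of_lt_pi hφ0 (by linarith)
  refine ⟨sφ, ?_⟩
  have h1 : sin φ ≤ sin β := aux_sin_le hφ0.le hφβ (by linarith)
  have h3 : sin α * sin φ ≤ sin γ := by
    rcases le_total α γ with h | h
    · have := aux_sin_le hα.le h (by linarith)
      nlinarith [sin_le_one φ]
    · have := aux_sin_le (y := γ) hφ0.le (by linarith) (by linarith)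
      nlinarith [sin_le_one α]
  calc _ = sin φ * (sin α * sin φ) := by ring
    _ ≤ _ := mul_le_mul h1 h3 (by positivity) (by linarith)

theorem aux_trig (α β γ ε : ℝ) (hα : 0 < α) (hβ : 0 < β) (hγ : 0 < γ) (hs : α + β + γ = π)
    (hε : 0 ≤ ε) (h : α ≤ (1 + ε) * min α (min β γ)) :
    0 < sin ((π - max α (max β γ)) / (2 + ε)) ∧
    sin α * sin ((π - max α (max β γ)) / (2 + ε)) ^ 2 ≤ sin β * sin γ := by
  rcases le_total β γ with hl | hl
  · exact aux_trig0 α β γ ε hα hβ hγ hs hε h hl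
  · rw [max_comm β γ, mul_comm (sin β)]
    rw [min_comm β γ] at h
    exact aux_trig0 α γ β ε hα hγ hβ (by linarith) hε h hl

theorem aux_area (A u v : EuclideanSpace ℝ (Fin 2)) :
    |u 0 * v 1 - u 1 * v 0| ≤ 2 *
      (volume (convexHull ℝ ({A, A + u, A + v} : Set (EuclideanSpace ℝ (Fin 2))))).toReal := by
  set T := convexHull ℝ ({A, A + u, A + v} : Set (EuclideanSpace ℝ (Fin 2))) with hT
  have hcpt : IsCompact T := Set.Finite.isCompact_convexHull (𝕜 := ℝ) (by simp)
  let M : Matrix (Fin 2) (Fin 2) ℝ := !![u 0, v 0; u 1, v 1]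
  let bs := (EuclideanSpace.basisFun (Fin 2) ℝ).toBasis
  let f := Matrix.toLin bs bs M
  have hdet : LinearMap.det f = u 0 * v 1 - u 1 * v 0 := by
    simp only [f, LinearMap.det_toLin, M, Matrix.det_fin_two_of]; ring
  have hf : ∀ x, f x = x 0 • u + x 1 • v := by
    intro x
    ext i
    fin_cases i <;>
    simp [f, bs, M, Matrix.toLin_apply, Matrix.mulVec, dotProduct, Fin.sum_univ_two] <;> ring
  let S : Set (EuclideanSpace ℝ (Fin 2)) := WithLp.ofLp ⁻¹' (Set.Icc 0 1)
  have hS : volume S = 1 := by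
    rw [(PiLp.volume_preserving_ofLp (Fin 2)).measure_preimage measurableSet_Icc.nullMeasurableSet]
    simp [Real.volume_Icc_pi]
  have hvol := Measure.addHaar_image_linearMap (volume : Measure (EuclideanSpace ℝ (Fin 2))) f S
  rw [hS, mul_one, hdet] at hvol
  have hmem : ∀ a b : ℝ, 0 ≤ a → 0 ≤ b → a + b ≤ 1 → A + (a • u + b • v) ∈ T := by
    intro a b ha hb hab
    have hc : Convex ℝ T := convex_convexHull _ _
    have h0 : A ∈ T := subset_convexHull _ _ (by simp)
    have h1 : A + u ∈ T := subset_convexHull _ _ (by simp)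
    have h2 : A + v ∈ T := subset_convexHull _ _ (by simp)
    have := hc.sum_mem (t := Finset.univ) (w := ![1 - a - b, a, b]) (z := ![A, A + u, A + v])
      (by intro i _; fin_cases i <;> simp <;> linarith)
      (by simp [Fin.sum_univ_three]; ring)
      (by intro i _; fin_cases i <;> simp [h0, h1, h2])
    convert this using 1
    simp only [Fin.sum_univ_three, Matrix.cons_val]
    module
  have hsub : f '' S ⊆ (fun x => A + x) ⁻¹' T ∪ (fun x => (A + (u + v)) - x) ⁻¹' T := by
    rintro _ ⟨x, hx, rfl⟩
    have hx0 := hx.1 0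
    have hx1 := hx.1 1
    have hx2 := hx.2 0
    have hx3 := hx.2 1
    simp only [Pi.zero_apply, Pi.one_apply] at hx0 hx1 hx2 hx3
    rw [hf]
    rcases le_total (x 0 + x 1) 1 with h | h
    · left
      exact hmem _ _ hx0 hx1 h
    · right
      have := hmem (1 - x 0) (1 - x 1) (by linarith) (by linarith) (by linarith)
      change A + (u + v) - _ ∈ T
      convert this using 1
      module
  have hm := measure_mono (μ := volume) hsub
  have hm2 := hm.trans (measure_union_le _ _)
  rw [hvol, measure_preimage_add,
    (Measure.measurePreserving_sub_left volume (A + (u + v))).measure_preimage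
      hcpt.measurableSet.nullMeasurableSet] at hm2
  have hfin : volume T ≠ ⊤ := hcpt.measure_lt_top.ne
  have := ENNReal.toReal_mono (by simp [hfin]) hm2
  rw [ENNReal.toReal_ofReal (abs_nonneg _), ENNReal.toReal_add hfin hfin] at this
  linarith

/-- For a nondegenerate triangle with vertices `A, B, C`, minimum
interior angle `θm` and maximum interior angle `θM`, if the side `e = [B, C]`
(whose opposite interior angle is `∠ B A C`) satisfies `∠ B A C ≤ (1+ε)·θm` for
some `ε ≥ 0`, then every affine function `w x = ⟪p, x⟫ + c` satisfies
`|w C − w B| ≤ κ · √(area T) · ‖p‖` with `κ = √2 / sin((π − θM)/(2 + ε))`. -/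
theorem stmt0 (A B C : EuclideanSpace ℝ (Fin 2))
    (hind : AffineIndependent ℝ ![A, B, C])
    (θm θM ε : ℝ)
    (hθm : θm = min (∠ B A C) (min (∠ A B C) (∠ A C B)))
    (hθM : θM = max (∠ B A C) (max (∠ A B C) (∠ A C B)))
    (hε : 0 ≤ ε)
    (hopp : ∠ B A C ≤ (1 + ε) * θm)
    (p : EuclideanSpace ℝ (Fin 2)) (c : ℝ)
    (w : EuclideanSpace ℝ (Fin 2) → ℝ)
    (hw : ∀ x, w x = ⟪p, x⟫ + c) :
    |w C - w B| ≤ (Real.sqrt 2 / Real.sin ((Real.pi - θM) / (2 + ε))) *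
      Real.sqrt (volume (convexHull ℝ ({A, B, C} : Set (EuclideanSpace ℝ (Fin 2))))).toReal *
      ‖p‖ := by
  have hnc : ¬ Collinear ℝ ({A, B, C} : Set (EuclideanSpace ℝ (Fin 2))) :=
    affineIndependent_iff_not_collinear_set.1 hind
  have hnc1 : ¬ Collinear ℝ ({B, A, C} : Set (EuclideanSpace ℝ (Fin 2))) := by
    rwa [Set.insert_comm]
  have hnc2 : ¬ Collinear ℝ ({A, C, B} : Set (EuclideanSpace ℝ (Fin 2))) := by
    rwa [Set.pair_comm C B]
  have sα := sin_pos_of_not_collinear hnc1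
  have pos : ∀ {x : ℝ}, 0 ≤ x → 0 < sin x → 0 < x := by
    intro x h0 h1
    rcases h0.eq_or_lt with h | h
    · rw [← h] at h1; simp at h1
    · exact h
  have hsum : ∠ B A C + ∠ A B C + ∠ A C B = π := by
    have := angle_add_angle_add_angle_eq_pi (p₁ := B) (p₂ := A) C (ne₁₂_of_not_collinear hnc)
    rw [angle_comm C B A] at this
    linarith
  rw [hθm] at hopp
  obtain ⟨sφ, key⟩ := aux_trig _ _ _ ε (pos (angle_nonneg _ _ _) sα)
    (pos (angle_nonneg _ _ _) (sin_pos_of_not_collinear hnc))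
    (pos (angle_nonneg _ _ _) (sin_pos_of_not_collinear hnc2)) hsum hε hopp
  rw [← hθM] at sφ key
  have harea := aux_area A (B - A) (C - A)
  rw [add_sub_cancel, add_sub_cancel] at harea
  set V := (volume (convexHull ℝ ({A, B, C} : Set (EuclideanSpace ℝ (Fin 2))))).toReal
  have hV : 0 ≤ V := ENNReal.toReal_nonneg
  have hd : sin (∠ B A C) * (dist A B * dist A C) ≤ 2 * V := by
    refine le_trans (le_of_eq ?_) harea
    rw [dist_comm A B, dist_comm A C, dist_eq_norm, dist_eq_norm]
    unfold EuclideanGeometry.angle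
    rw [vsub_eq_sub, vsub_eq_sub, InnerProductGeometry.sin_angle_mul_norm_mul_norm,
      ← Real.sqrt_sq_eq_abs]
    congr 1
    simp only [PiLp.inner_apply, Fin.sum_univ_two, RCLike.inner_apply, conj_trivial]
    ring
  have l1 : sin (∠ B A C) * dist A C = sin (∠ A B C) * dist B C := by
    have := sin_angle_mul_dist_eq_sin_angle_mul_dist B A C
    rw [this, angle_comm C B A, dist_comm C B]
  have l2 : sin (∠ B A C) * dist A B = sin (∠ A C B) * dist B C := by
    have := sin_angle_mul_dist_eq_sin_angle_mul_dist C A B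
    rw [angle_comm, this, angle_comm]
  have hbound : (dist B C * sin ((π - θM) / (2 + ε))) ^ 2 ≤ 2 * V := by
    set s := sin ((π - θM) / (2 + ε))
    refine le_of_mul_le_mul_left ?_ sα
    calc _ = (sin (∠ B A C) * s ^ 2) * dist B C ^ 2 := by ring
      _ ≤ (sin (∠ A B C) * sin (∠ A C B)) * dist B C ^ 2 := by gcongr
      _ = (sin (∠ A B C) * dist B C) * (sin (∠ A C B) * dist B C) := by ring
      _ = sin (∠ B A C) * (sin (∠ B A C) * (dist A B * dist A C)) := by
        rw [← l1, ← l2]; ring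
      _ ≤ _ := by gcongr
  have h1 : |w C - w B| ≤ ‖p‖ * dist B C := by
    have : w C - w B = ⟪p, C - B⟫ := by rw [hw, hw, inner_sub_right]; ring
    rw [this, dist_comm, dist_eq_norm]
    exact abs_real_inner_le_norm _ _
  have h2 : dist B C ≤ √2 / sin ((π - θM) / (2 + ε)) * √V := by
    rw [div_mul_eq_mul_div, le_div_iff₀ sφ, ← Real.sqrt_mul (by norm_num)]
    exact Real.le_sqrt_of_sq_le hbound
  calc _ ≤ ‖p‖ * dist B C := h1
    _ ≤ ‖p‖ * (√2 / sin ((π - θM) / (2 + ε)) * √V) := by gcongr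
    _ = _ := by ring
end

section
/- Let T be a nondegenerate triangle in the Euclidean plane ℝ² with vertices A₁, A₂, A₃. For i = 1,2,3 let θ_i be the interior angle at A_i, let e_i be the side opposite A_i, let |e_i| be its length, let t_i be a unit vector parallel to e_i, and let R be the circumradius of T. Then for every vector p ∈ ℝ²: area(T)·‖p‖² = R · Σ_{i=1}^{3} cos(θ_i) · |e_i| · ⟨p, t_i⟩². -/
open MeasureTheory EuclideanGeometry Real
open scoped RealInnerProductSpace

abbrev E2 := EuclideanSpace ℝ (Fin 2)

theorem std_tri : volume {x : E2 | 0 ≤ x 0 ∧ 0 ≤ x 1 ∧ x 0 + x 1 ≤ 1} = ENNReal.ofReal (1/2) := by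
  have h1 : volume {q : ℝ × ℝ | 0 ≤ q.1 ∧ 0 ≤ q.2 ∧ q.1 + q.2 ≤ 1} = ENNReal.ofReal (1/2) := by
    have hm : MeasurableSet {q : ℝ × ℝ | 0 ≤ q.1 ∧ 0 ≤ q.2 ∧ q.1 + q.2 ≤ 1} := by
      measurability
    rw [Measure.volume_eq_prod, Measure.prod_apply hm]
    have : ∀ x : ℝ, volume (Prod.mk x ⁻¹' {q : ℝ × ℝ | 0 ≤ q.1 ∧ 0 ≤ q.2 ∧ q.1 + q.2 ≤ 1}) = (Set.Icc (0:ℝ) 1).indicator (fun x => ENNReal.ofReal (1 - x)) x := by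
      intro x
      by_cases hx : x ∈ Set.Icc (0:ℝ) 1
      · rw [Set.indicator_of_mem hx]
        have : (Prod.mk x ⁻¹' {q : ℝ × ℝ | 0 ≤ q.1 ∧ 0 ≤ q.2 ∧ q.1 + q.2 ≤ 1}) = Set.Icc 0 (1 - x) := by
          ext y
          simp only [Set.mem_preimage, Set.mem_ofPred_eq, Set.mem_Icc] at *
          constructor
          · rintro ⟨a, b, c⟩; exact ⟨b, by linarith⟩
          · rintro ⟨a, b⟩; exact ⟨hx.1, a, by linarith⟩
        rw [this, Real.volume_Icc, sub_zero]
      · rw [Set.indicator_of_notMem hx]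
        have : (Prod.mk x ⁻¹' {q : ℝ × ℝ | 0 ≤ q.1 ∧ 0 ≤ q.2 ∧ q.1 + q.2 ≤ 1}) = ∅ := by
          ext y
          simp only [Set.mem_preimage, Set.mem_ofPred_eq, Set.mem_Icc, Set.mem_empty_iff_false, iff_false] at *
          rintro ⟨a, b, c⟩; exact hx ⟨a, by linarith⟩
        rw [this, measure_empty]
    simp_rw [this]
    rw [lintegral_indicator measurableSet_Icc, ← ofReal_integral_eq_lintegral_ofReal]
    · rw [integral_Icc_eq_integral_Ioc, ← intervalIntegral.integral_of_le (by norm_num)]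
      congr 1
      rw [intervalIntegral.integral_sub (by simp) (by simp)]
      norm_num [integral_id]
    · exact (by fun_prop : Continuous fun x : ℝ => 1 - x).continuousOn.integrableOn_compact isCompact_Icc
    · filter_upwards [ae_restrict_mem measurableSet_Icc] with x hx
      simpa using hx.2
  rw [← h1]
  have e1 := (EuclideanSpace.volume_preserving_symm_measurableEquiv_toLp (Fin 2))
  have e2 := volume_preserving_finTwoArrow ℝ
  have e3 := e2.comp e1
  rw [← e3.measure_preimage_equiv (f := (MeasurableEquiv.toLp 2 (Fin 2 → ℝ)).symm.trans MeasurableEquiv.finTwoArrow)]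
  rfl

theorem tri_area (A B C : E2) : (volume (convexHull ℝ ({A, B, C} : Set E2))).toReal
    = |(B 0 - A 0) * (C 1 - A 1) - (B 1 - A 1) * (C 0 - A 0)| / 2 := by
  let M : Matrix (Fin 2) (Fin 2) ℝ := !![B 0 - A 0, C 0 - A 0; B 1 - A 1, C 1 - A 1]
  let b := (EuclideanSpace.basisFun (Fin 2) ℝ).toBasis
  let f : E2 →ₗ[ℝ] E2 := Matrix.toLin b b M
  have hf : ∀ x : E2, f x = x 0 • (B - A) + x 1 • (C - A) := by
    intro x
    ext i
    fin_cases i <;> simp [f, b, M, Matrix.toLin_apply, Matrix.mulVec, dotProduct, Fin.sum_univ_two] <;> ring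
  have hS : convexHull ℝ ({A, B, C} : Set E2) = (fun y => A + y) '' (f '' {x : E2 | 0 ≤ x 0 ∧ 0 ≤ x 1 ∧ x 0 + x 1 ≤ 1}) := by
    apply subset_antisymm
    · apply convexHull_min
      · rintro x (rfl | rfl | rfl)
        · exact ⟨_, ⟨0, by simp, rfl⟩, by simp⟩
        · exact ⟨_, ⟨!₂[1, 0], by simp, rfl⟩, by simp [hf]⟩
        · exact ⟨_, ⟨!₂[0, 1], by simp, rfl⟩, by simp [hf]⟩
      · have hc : Convex ℝ {x : E2 | 0 ≤ x 0 ∧ 0 ≤ x 1 ∧ x 0 + x 1 ≤ 1} := by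
          rintro x ⟨h1, h2, h3⟩ y ⟨k1, k2, k3⟩ a b ha hb hab
          simp only [Set.mem_ofPred_eq, PiLp.add_apply, PiLp.smul_apply, smul_eq_mul]
          refine ⟨by positivity, by positivity, by nlinarith⟩
        exact (hc.linear_image f).translate A
    · rintro _ ⟨_, ⟨x, ⟨h0, h1, h2⟩, rfl⟩, rfl⟩
      have hA : A ∈ convexHull ℝ ({A, B, C} : Set E2) := subset_convexHull _ _ (by simp)
      have hB : B ∈ convexHull ℝ ({A, B, C} : Set E2) := subset_convexHull _ _ (by simp)
      have hC : C ∈ convexHull ℝ ({A, B, C} : Set E2) := subset_convexHull _ _ (by simp)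
      have := (convex_convexHull ℝ ({A, B, C} : Set E2)).sum_mem (t := Finset.univ)
        (w := ![1 - x 0 - x 1, x 0, x 1]) (z := ![A, B, C])
        (by intro i _; fin_cases i <;> simp <;> linarith)
        (by simp [Fin.sum_univ_three]; ring)
        (by intro i _; fin_cases i <;> simpa)
      convert this using 1
      simp only [Fin.sum_univ_three, hf]
      simp
      module
  rw [hS, Set.image_add_left, measure_preimage_add, Measure.addHaar_image_linearMap, std_tri, LinearMap.det_toLin,
    ← ENNReal.ofReal_mul (abs_nonneg _), ENNReal.toReal_ofReal (by positivity), Matrix.det_fin_two]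
  simp only [M, Matrix.of_apply, Matrix.cons_val', Matrix.cons_val_zero, Matrix.cons_val_one]
  simp
  rw [mul_comm (C 0 - A 0)]
  ring

theorem det_ne (A B C : E2) (h : AffineIndependent ℝ ![A, B, C]) :
    (B 0 - A 0) * (C 1 - A 1) - (B 1 - A 1) * (C 0 - A 0) ≠ 0 := by
  intro hd
  rw [affineIndependent_iff] at h
  have key : ∀ b c : ℝ, b * (B 0 - A 0) + c * (C 0 - A 0) = 0 → b * (B 1 - A 1) + c * (C 1 - A 1) = 0 → b = 0 ∧ c = 0 := by
    intro b c h0 h1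
    have := h Finset.univ ![-b-c, b, c] (by simp [Fin.sum_univ_three]; ring) (by
      ext i
      fin_cases i <;> simp [Fin.sum_univ_three] <;> linarith)
    exact ⟨by simpa using this 1, by simpa using this 2⟩
  have h1 := key (C 1 - A 1) (-(B 1 - A 1)) (by linarith) (by ring)
  have h2 := key (C 0 - A 0) (-(B 0 - A 0)) (by ring) (by linarith)
  have h3 := key 1 0 (by linarith) (by linarith)
  exact one_ne_zero h3.1

theorem term_eq (X Y Z p t : E2) (R a b c D : ℝ) (ha : dist Y Z = a) (hb : dist X Y = b) (hc : dist X Z = c)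
    (ha0 : a ≠ 0) (hb0 : b ≠ 0) (hc0 : c ≠ 0) (hD : D ≠ 0)
    (hR : a * b * c = 2 * D * R) (ht : ‖t‖ = 1) (hp : ∃ s : ℝ, Z - Y = s • t) :
    R * (Real.cos (∠ Y X Z) * a * ⟪p, t⟫ ^ 2) = ⟪Y - X, Z - X⟫ * ⟪p, Z - Y⟫ ^ 2 / (2 * D) := by
  obtain ⟨s, hs⟩ := hp
  have hsa : s ^ 2 = a ^ 2 := by
    rw [← ha, dist_comm, dist_eq_norm, hs, norm_smul, ht, mul_one, Real.norm_eq_abs, sq_abs]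
  have hcos : Real.cos (∠ Y X Z) * (b * c) = ⟪Y - X, Z - X⟫ := by
    have := InnerProductGeometry.cos_angle_mul_norm_mul_norm (Y - X) (Z - X)
    rw [← this, ← hb, ← hc, dist_comm X Y, dist_comm X Z, dist_eq_norm, dist_eq_norm]
    rfl
  rw [hs, inner_smul_right, mul_pow, hsa, ← hcos, eq_div_iff (by positivity)]
  linear_combination (-Real.cos (∠ Y X Z) * a * ⟪p, t⟫ ^ 2) * hR

/-- cotangent formula. Let `A₁ A₂ A₃` be a nondegenerate triangle in
the plane with interior angles `θᵢ = ∠` at `Aᵢ`, circumcenter `O` and circumradius `R`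
(so `dist O Aᵢ = R`), unit vectors `tᵢ` parallel to the side `eᵢ` opposite `Aᵢ`.
Then for every `p ∈ ℝ²`:
`area(T)·‖p‖² = R · Σᵢ cos(θᵢ) · |eᵢ| · ⟨p, tᵢ⟩²`. -/
theorem stmt4 (A₁ A₂ A₃ O : EuclideanSpace ℝ (Fin 2))
    (hind : AffineIndependent ℝ ![A₁, A₂, A₃])
    (R : ℝ)
    (hR1 : dist O A₁ = R) (hR2 : dist O A₂ = R) (hR3 : dist O A₃ = R)
    (t₁ t₂ t₃ : EuclideanSpace ℝ (Fin 2))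
    (ht₁ : ‖t₁‖ = 1) (ht₂ : ‖t₂‖ = 1) (ht₃ : ‖t₃‖ = 1)
    (hpar₁ : ∃ s : ℝ, A₃ - A₂ = s • t₁)
    (hpar₂ : ∃ s : ℝ, A₃ - A₁ = s • t₂)
    (hpar₃ : ∃ s : ℝ, A₂ - A₁ = s • t₃)
    (p : EuclideanSpace ℝ (Fin 2)) :
    (volume (convexHull ℝ ({A₁, A₂, A₃} : Set (EuclideanSpace ℝ (Fin 2))))).toReal * ‖p‖ ^ 2 =
      R * (Real.cos (∠ A₂ A₁ A₃) * dist A₂ A₃ * ⟪p, t₁⟫ ^ 2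
         + Real.cos (∠ A₁ A₂ A₃) * dist A₁ A₃ * ⟪p, t₂⟫ ^ 2
         + Real.cos (∠ A₁ A₃ A₂) * dist A₁ A₂ * ⟪p, t₃⟫ ^ 2) := by
  have hd := det_ne _ _ _ hind
  have hsq : ∀ X Y : E2, dist X Y ^ 2 = (X 0 - Y 0) ^ 2 + (X 1 - Y 1) ^ 2 := by
    intro X Y
    rw [EuclideanSpace.dist_eq, Real.sq_sqrt (by positivity), Fin.sum_univ_two, Real.dist_eq, Real.dist_eq, sq_abs, sq_abs]
  have h12 : dist A₁ A₂ ≠ 0 := by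
    rw [dist_ne_zero]; rintro rfl; exact hd (by ring)
  have h13 : dist A₁ A₃ ≠ 0 := by
    rw [dist_ne_zero]; rintro rfl; exact hd (by ring)
  have h23 : dist A₂ A₃ ≠ 0 := by
    rw [dist_ne_zero]; rintro rfl; exact hd (by ring)
  have hR0 : 0 ≤ R := hR1 ▸ dist_nonneg
  rw [tri_area]
  set d := (A₂ 0 - A₁ 0) * (A₃ 1 - A₁ 1) - (A₂ 1 - A₁ 1) * (A₃ 0 - A₁ 0) with hdd
  have hD : |d| ≠ 0 := abs_ne_zero.2 hd
  have hR : dist A₂ A₃ * dist A₁ A₂ * dist A₁ A₃ = 2 * |d| * R := by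
    rw [← sq_eq_sq₀ (by positivity) (by positivity)]
    simp only [mul_pow, sq_abs, hsq]
    have e1 := hsq O A₁
    have e2 := hsq O A₂
    have e3 := hsq O A₃
    rw [hR1] at e1
    rw [hR2] at e2
    rw [hR3] at e3
    have q0 : 2 * d * (O 0 - A₁ 0) = ((A₂ 0 - A₁ 0)^2 + (A₂ 1 - A₁ 1)^2) * (A₃ 1 - A₁ 1) - ((A₃ 0 - A₁ 0)^2 + (A₃ 1 - A₁ 1)^2) * (A₂ 1 - A₁ 1) := by
      rw [hdd]
      linear_combination (A₃ 1 - A₁ 1) * (e2 - e1) - (A₂ 1 - A₁ 1) * (e3 - e1)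
    have q1 : 2 * d * (O 1 - A₁ 1) = -((A₂ 0 - A₁ 0)^2 + (A₂ 1 - A₁ 1)^2) * (A₃ 0 - A₁ 0) + ((A₃ 0 - A₁ 0)^2 + (A₃ 1 - A₁ 1)^2) * (A₂ 0 - A₁ 0) := by
      rw [hdd]
      linear_combination -(A₃ 0 - A₁ 0) * (e2 - e1) + (A₂ 0 - A₁ 0) * (e3 - e1)
    have : 2 ^ 2 * d ^ 2 * R ^ 2 = (2 * d * (O 0 - A₁ 0)) ^ 2 + (2 * d * (O 1 - A₁ 1)) ^ 2 := by
      rw [e1]; ring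
    rw [this, q0, q1]
    ring
  rw [mul_add, mul_add,
    term_eq A₁ A₂ A₃ p t₁ R _ _ _ |d| rfl rfl rfl h23 h12 h13 hD hR ht₁ hpar₁,
    term_eq A₂ A₁ A₃ p t₂ R _ _ _ |d| rfl (dist_comm _ _) rfl h13 h12 h23 hD (by linarith) ht₂ hpar₂,
    term_eq A₃ A₁ A₂ p t₃ R _ _ _ |d| rfl (dist_comm _ _) (dist_comm _ _) h12 h13 h23 hD (by linarith) ht₃ hpar₃]
  rw [← add_div, ← add_div, eq_div_iff (by positivity), EuclideanSpace.norm_sq_eq]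
  have : |d| * |d| = d * d := abs_mul_abs_self d
  simp only [PiLp.inner_apply, Fin.sum_univ_two, PiLp.sub_apply, RCLike.inner_apply, conj_trivial, Real.norm_eq_abs, sq_abs]
  have h : ∀ z : ℝ, |d| / 2 * z * (2 * |d|) = d * d * z := by
    intro z; rw [← this]; ring
  rw [h, hdd]
  ring
end

section
/- Let T be a nondegenerate triangle in the Euclidean plane ℝ² with maximum interior angle θ_M and diameter h_T. For i = 1,2,3 let e_i be the sides of T, with lengths |e_i| and unit tangent vectors t_i. Then for every vector p ∈ ℝ²: √(area T) · ‖p‖ ≤ √(h_T / (2·sin(θ_M))) · Σ_{i=1}^{3} √|e_i| · |⟨p, t_i⟩|. In particular, for every affine function v on T, the L² norm of its gradient over T is bounded by √(h_T/(2 sin θ_M)) times the sum over the three sides of the L² norms over the sides of the tangential derivatives ∇v · t_i. -/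
open MeasureTheory EuclideanGeometry Real
open scoped RealInnerProductSpace

lemma aux_meas : MeasurableSet {x : ℝ × ℝ | 0 ≤ x.1 ∧ 0 ≤ x.2 ∧ x.1 + x.2 ≤ 1} := by
  have h1 : MeasurableSet {x : ℝ × ℝ | 0 ≤ x.1} := measurableSet_le (by fun_prop) (by fun_prop)
  have h2 : MeasurableSet {x : ℝ × ℝ | 0 ≤ x.2} := measurableSet_le (by fun_prop) (by fun_prop)
  have h3 : MeasurableSet {x : ℝ × ℝ | x.1 + x.2 ≤ 1} :=
    measurableSet_le (by fun_prop) (by fun_prop)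
  exact h1.inter (h2.inter h3)

lemma aux_S : (volume {x : ℝ × ℝ | 0 ≤ x.1 ∧ 0 ≤ x.2 ∧ x.1 + x.2 ≤ 1}) ≤ ENNReal.ofReal (1/2) := by
  have hm : MeasurableSet {x : ℝ × ℝ | 0 ≤ x.1 ∧ 0 ≤ x.2 ∧ x.1 + x.2 ≤ 1} := aux_meas
  rw [Measure.volume_eq_prod, Measure.prod_apply hm]
  have h1 : ∀ x : ℝ, volume (Prod.mk x ⁻¹' {x : ℝ × ℝ | 0 ≤ x.1 ∧ 0 ≤ x.2 ∧ x.1 + x.2 ≤ 1})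
      ≤ (Set.Icc (0:ℝ) 1).indicator (fun x => ENNReal.ofReal (1 - x)) x := by
    intro x
    by_cases hx : x ∈ Set.Icc (0:ℝ) 1
    · rw [Set.indicator_of_mem hx]
      calc _ ≤ volume (Set.Icc (0:ℝ) (1 - x)) := by
            apply measure_mono
            rintro y ⟨_, h2, h3⟩
            simp only at h2 h3
            exact ⟨h2, by linarith⟩
        _ = _ := by rw [Real.volume_Icc]; simp
    · rw [Set.indicator_of_notMem hx]
      have : (Prod.mk x ⁻¹' {x : ℝ × ℝ | 0 ≤ x.1 ∧ 0 ≤ x.2 ∧ x.1 + x.2 ≤ 1}) = ∅ := by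
        ext y
        simp only [Set.mem_preimage, Set.mem_ofPred_eq, Set.mem_empty_iff_false, iff_false]
        rintro ⟨h1, h2, h3⟩
        exact hx ⟨h1, by linarith⟩
      rw [this]; simp
  refine (lintegral_mono h1).trans ?_
  rw [lintegral_indicator measurableSet_Icc, ← ofReal_integral_eq_lintegral_ofReal]
  · rw [integral_Icc_eq_integral_Ioc, ← intervalIntegral.integral_of_le zero_le_one]
    apply ENNReal.ofReal_le_ofReal
    rw [intervalIntegral.integral_sub (by simp) (by simp)]
    simp
    norm_num
  · exact (Continuous.continuousOn (by fun_prop)).integrableOn_Icc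
  · refine (ae_restrict_iff' measurableSet_Icc).2 (ae_of_all _ ?_)
    intro x hx
    simp only [Pi.zero_apply]
    linarith [hx.2]

lemma aux_S2 : (volume {x : EuclideanSpace ℝ (Fin 2) | 0 ≤ x 0 ∧ 0 ≤ x 1 ∧ x 0 + x 1 ≤ 1})
    ≤ ENNReal.ofReal (1/2) := by
  have hmp := (volume_preserving_finTwoArrow ℝ).comp (PiLp.volume_preserving_ofLp (Fin 2))
  have hm : MeasurableSet {x : ℝ × ℝ | 0 ≤ x.1 ∧ 0 ≤ x.2 ∧ x.1 + x.2 ≤ 1} := aux_meas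
  have := hmp.measure_preimage hm.nullMeasurableSet
  refine le_trans (le_of_eq ?_) (this.le.trans aux_S)
  rfl

lemma aux_vol (A B C : EuclideanSpace ℝ (Fin 2)) :
    (volume (convexHull ℝ ({A, B, C} : Set (EuclideanSpace ℝ (Fin 2))))).toReal ≤
      |(B - A) 0 * (C - A) 1 - (C - A) 0 * (B - A) 1| / 2 := by
  set M : Matrix (Fin 2) (Fin 2) ℝ := !![(B - A) 0, (C - A) 0; (B - A) 1, (C - A) 1] with hM
  set L := Matrix.toLin (EuclideanSpace.basisFun (Fin 2) ℝ).toBasis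
    (EuclideanSpace.basisFun (Fin 2) ℝ).toBasis M with hL
  have hdet : LinearMap.det L = (B - A) 0 * (C - A) 1 - (C - A) 0 * (B - A) 1 := by
    rw [hL, LinearMap.det_toLin, hM, Matrix.det_fin_two_of]
  have hLx : ∀ x, L x = x 0 • (B - A) + x 1 • (C - A) := by
    intro x
    rw [hL, Matrix.toLin_apply]
    ext i
    fin_cases i <;> simp [hM, Matrix.mulVec, dotProduct, Fin.sum_univ_two, EuclideanSpace.basisFun_apply] <;> ring
  have hsub : convexHull ℝ ({A, B, C} : Set (EuclideanSpace ℝ (Fin 2))) ⊆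
      (fun x => A + x) '' (L '' {x | 0 ≤ x 0 ∧ 0 ≤ x 1 ∧ x 0 + x 1 ≤ 1}) := by
    have hS : Convex ℝ {x : EuclideanSpace ℝ (Fin 2) | 0 ≤ x 0 ∧ 0 ≤ x 1 ∧ x 0 + x 1 ≤ 1} := by
      rintro x ⟨h1, h2, h3⟩ y ⟨g1, g2, g3⟩ a b ha hb hab
      simp only [Set.mem_ofPred_eq, PiLp.add_apply, PiLp.smul_apply, smul_eq_mul]
      refine ⟨by positivity, by positivity, ?_⟩
      nlinarith
    refine convexHull_min ?_ ((hS.linear_image L).translate A)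
    intro x hx
    rcases hx with rfl | rfl | rfl
    · exact ⟨0, ⟨0, by simp, by simp⟩, by simp⟩
    · exact ⟨_, ⟨!₂[1, 0], by simp, rfl⟩, by simp [hLx]⟩
    · exact ⟨_, ⟨!₂[0, 1], by simp, rfl⟩, by simp [hLx]⟩
  have h := measure_mono (μ := volume) hsub
  rw [Set.image_add_left, measure_preimage_add, Measure.addHaar_image_linearMap, hdet] at h
  have h2 := h.trans (mul_le_mul_right aux_S2 _)
  rw [← ENNReal.ofReal_mul (abs_nonneg _)] at h2
  refine ENNReal.toReal_le_of_le_ofReal (by positivity) ?_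
  refine h2.trans (le_of_eq ?_)
  congr 1
  ring

lemma aux_main (A B C : EuclideanSpace ℝ (Fin 2)) (h : ℝ) (hb : dist A B ≤ h) (hc : dist A C ≤ h)
    (t r : EuclideanSpace ℝ (Fin 2)) (ht : ‖t‖ = 1) (hr : ‖r‖ = 1)
    (hpt : ∃ s : ℝ, B - A = s • t) (hpr : ∃ s : ℝ, C - A = s • r)
    (p : EuclideanSpace ℝ (Fin 2)) :
    √(volume (convexHull ℝ ({A, B, C} : Set (EuclideanSpace ℝ (Fin 2))))).toReal * ‖p‖ ≤
      √(h / (2 * Real.sin (∠ B A C))) *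
        (√(dist A B) * |⟪p, t⟫| + √(dist A C) * |⟪p, r⟫|) := by
  have hv := aux_vol A B C
  obtain ⟨σ, hσ⟩ := hpt
  obtain ⟨τ, hτ⟩ := hpr
  have hdb : dist A B = |σ| := by
    rw [dist_comm, dist_eq_norm, hσ, norm_smul, ht]; simp
  have hdc : dist A C = |τ| := by
    rw [dist_comm, dist_eq_norm, hτ, norm_smul, hr]; simp
  have hang : ∠ B A C = InnerProductGeometry.angle (σ • t) (τ • r) := by
    rw [EuclideanGeometry.angle, vsub_eq_sub, vsub_eq_sub, hσ, hτ]
  have ht2 : t 0 ^ 2 + t 1 ^ 2 = 1 := by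
    have := EuclideanSpace.real_norm_sq_eq t
    rw [ht, Fin.sum_univ_two] at this; linarith
  have hr2 : r 0 ^ 2 + r 1 ^ 2 = 1 := by
    have := EuclideanSpace.real_norm_sq_eq r
    rw [hr, Fin.sum_univ_two] at this; linarith
  have hp2 : ‖p‖ ^ 2 = p 0 ^ 2 + p 1 ^ 2 := by
    rw [EuclideanSpace.real_norm_sq_eq p, Fin.sum_univ_two]
  have hin : ∀ x y : EuclideanSpace ℝ (Fin 2), ⟪x, y⟫ = x 0 * y 0 + x 1 * y 1 := by
    intro x y
    simp [PiLp.inner_apply, Fin.sum_univ_two]; ring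
  rw [hdb] at hb
  rw [hdc] at hc
  have hs0 : 0 ≤ Real.sin (∠ B A C) := InnerProductGeometry.sin_angle_nonneg _ _
  have hsn := InnerProductGeometry.sin_angle_mul_norm_mul_norm (σ • t) (τ • r)
  rw [← hang, norm_smul, norm_smul, ht, hr, Real.norm_eq_abs, Real.norm_eq_abs] at hsn
  set s := Real.sin (∠ B A C) with hs
  set d := t 0 * r 1 - r 0 * t 1 with hd
  have hsn' : s * (|σ| * |τ|) = |σ| * |τ| * |d| := by
    rw [mul_one, mul_one] at hsn
    rw [hsn, ← abs_mul, ← abs_mul, ← Real.sqrt_sq_eq_abs]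
    congr 1
    simp only [hin, PiLp.smul_apply, smul_eq_mul, hd]
    ring
  rw [hσ, hτ] at hv
  have hv' : (volume (convexHull ℝ ({A, B, C} : Set (EuclideanSpace ℝ (Fin 2))))).toReal ≤
      |σ| * |τ| * |d| / 2 := by
    refine hv.trans (le_of_eq ?_)
    rw [← abs_mul, ← abs_mul]
    simp only [PiLp.smul_apply, smul_eq_mul, hd]
    congr 2; ring
  rw [hdb, hdc]
  have hsp : |d| * ‖p‖ ≤ |⟪p, t⟫| + |⟪p, r⟫| := by
    have h1 : |⟪t, r⟫| ≤ 1 := by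
      have := abs_real_inner_le_norm t r
      rwa [ht, hr, mul_one] at this
    refine abs_le_of_sq_le_sq' ?_ (by positivity) |>.2
    have e : (|d| * ‖p‖)^2 = ⟪p, t⟫^2 + ⟪p, r⟫^2 - 2 * (⟪p, t⟫ * ⟪p, r⟫ * ⟪t, r⟫) := by
      rw [mul_pow, sq_abs, hp2, hin, hin, hin, hd]
      have a : (p 0 * t 0 + p 1 * t 1)^2 = (p 0 * t 0 + p 1 * t 1)^2 * (r 0 ^ 2 + r 1 ^ 2) := by
        rw [hr2, mul_one]
      have b : (p 0 * r 0 + p 1 * r 1)^2 = (p 0 * r 0 + p 1 * r 1)^2 * (t 0 ^ 2 + t 1 ^ 2) := by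
        rw [ht2, mul_one]
      rw [a, b]; ring
    have f : -(⟪p, t⟫ * ⟪p, r⟫ * ⟪t, r⟫) ≤ |⟪p, t⟫| * |⟪p, r⟫| := by
      refine (neg_le_abs _).trans ?_
      rw [abs_mul, abs_mul]
      exact mul_le_of_le_one_right (by positivity) h1
    rw [e, add_sq, sq_abs, sq_abs]
    linarith
  have hR : 0 ≤ √(h / (2 * s)) * (√|σ| * |⟪p, t⟫| + √|τ| * |⟪p, r⟫|) := by positivity
  by_cases h0 : |σ| * |τ| * |d| = 0
  · rw [h0] at hv'
    rw [Real.sqrt_eq_zero_of_nonpos (by linarith), zero_mul]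
    exact hR
  have hστ : |σ| * |τ| ≠ 0 := fun hh => h0 (by rw [hh, zero_mul])
  have hsd : s = |d| := by
    apply mul_left_cancel₀ hστ; linarith
  have hdpos : 0 < |d| := lt_of_le_of_ne (abs_nonneg _) (fun hh => h0 (by rw [← hh, mul_zero]))
  rw [hsd]
  have hh0 : 0 ≤ h := (abs_nonneg σ).trans hb
  have k1 : √(|σ| * |τ| * |d| / 2) = √(|σ|) * √(|τ|) * (√(1 / (2 * |d|)) * |d|) := by
    rw [← Real.sqrt_mul (abs_nonneg _)]
    nth_rw 3 [← Real.sqrt_sq hdpos.le]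
    rw [← Real.sqrt_mul (by positivity), ← Real.sqrt_mul (by positivity)]
    congr 1
    field_simp
  have k2 : √(h / (2 * |d|)) = √h * √(1 / (2 * |d|)) := by
    rw [← Real.sqrt_mul hh0]; congr 1; ring
  calc _ ≤ √(|σ| * |τ| * |d| / 2) * ‖p‖ := by gcongr
    _ = √(1 / (2 * |d|)) * (√(|σ|) * √(|τ|)) * (|d| * ‖p‖) := by rw [k1]; ring
    _ ≤ √(1 / (2 * |d|)) * (√(|σ|) * √(|τ|)) * (|⟪p, t⟫| + |⟪p, r⟫|) := by gcongr
    _ = √(1 / (2 * |d|)) * (√(|τ|) * (√|σ| * |⟪p, t⟫|) + √(|σ|) * (√|τ| * |⟪p, r⟫|)) := by ring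
    _ ≤ √(1 / (2 * |d|)) * (√h * (√|σ| * |⟪p, t⟫|) + √h * (√|τ| * |⟪p, r⟫|)) := by gcongr
    _ = _ := by rw [k2]; ring

/-- Lemma C.1. Let `A₁ A₂ A₃` be a nondegenerate triangle in the
plane with maximum interior angle `θM` and diameter `hT` (its longest side length),
and let `tᵢ` be unit vectors parallel to the sides `eᵢ` (the side opposite `Aᵢ`).
Then for every `p ∈ ℝ²`:
`√(area T) · ‖p‖ ≤ √(hT/(2 sin θM)) · Σᵢ √|eᵢ| · |⟨p, tᵢ⟩|`. -/
theorem stmt5 (A₁ A₂ A₃ : EuclideanSpace ℝ (Fin 2))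
    (hind : AffineIndependent ℝ ![A₁, A₂, A₃])
    (θM hT : ℝ)
    (hθM : θM = max (∠ A₂ A₁ A₃) (max (∠ A₁ A₂ A₃) (∠ A₁ A₃ A₂)))
    (hhT : hT = max (dist A₂ A₃) (max (dist A₁ A₃) (dist A₁ A₂)))
    (t₁ t₂ t₃ : EuclideanSpace ℝ (Fin 2))
    (ht₁ : ‖t₁‖ = 1) (ht₂ : ‖t₂‖ = 1) (ht₃ : ‖t₃‖ = 1)
    (hpar₁ : ∃ s : ℝ, A₃ - A₂ = s • t₁)
    (hpar₂ : ∃ s : ℝ, A₃ - A₁ = s • t₂)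
    (hpar₃ : ∃ s : ℝ, A₂ - A₁ = s • t₃)
    (p : EuclideanSpace ℝ (Fin 2)) :
    Real.sqrt (volume (convexHull ℝ ({A₁, A₂, A₃} : Set (EuclideanSpace ℝ (Fin 2))))).toReal
        * ‖p‖ ≤
      Real.sqrt (hT / (2 * Real.sin θM)) *
        (Real.sqrt (dist A₂ A₃) * |⟪p, t₁⟫| + Real.sqrt (dist A₁ A₃) * |⟪p, t₂⟫|
          + Real.sqrt (dist A₁ A₂) * |⟪p, t₃⟫|) := by
  have ha : dist A₂ A₃ ≤ hT := hhT ▸ le_max_left _ _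
  have hb : dist A₁ A₃ ≤ hT := hhT ▸ (le_max_left _ _).trans (le_max_right _ _)
  have hc : dist A₁ A₂ ≤ hT := hhT ▸ (le_max_right _ _).trans (le_max_right _ _)
  have flip : ∀ {X Y t : EuclideanSpace ℝ (Fin 2)}, (∃ s : ℝ, X - Y = s • t) →
      ∃ s : ℝ, Y - X = s • t := by
    rintro X Y t ⟨s, hs⟩
    exact ⟨-s, by rw [neg_smul, ← hs, neg_sub]⟩
  have m1 := aux_main A₁ A₂ A₃ hT hc hb t₃ t₂ ht₃ ht₂ hpar₃ hpar₂ p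
  have m2 := aux_main A₂ A₁ A₃ hT (by rwa [dist_comm]) ha t₃ t₁ ht₃ ht₁ (flip hpar₃) hpar₁ p
  have m3 := aux_main A₃ A₁ A₂ hT (by rwa [dist_comm]) (by rwa [dist_comm]) t₂ t₁ ht₂ ht₁
    (flip hpar₂) (flip hpar₁) p
  rw [Set.insert_comm A₂ A₁, dist_comm A₂ A₁] at m2
  rw [Set.insert_comm A₃ A₁, Set.pair_comm A₃ A₂, dist_comm A₃ A₁, dist_comm A₃ A₂] at m3
  have n1 : 0 ≤ √(dist A₂ A₃) * |⟪p, t₁⟫| := by positivity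
  have n2 : 0 ≤ √(dist A₁ A₃) * |⟪p, t₂⟫| := by positivity
  have n3 : 0 ≤ √(dist A₁ A₂) * |⟪p, t₃⟫| := by positivity
  have hcase : θM = ∠ A₂ A₁ A₃ ∨ θM = ∠ A₁ A₂ A₃ ∨ θM = ∠ A₁ A₃ A₂ := by
    rw [hθM]
    rcases max_choice (∠ A₂ A₁ A₃) (max (∠ A₁ A₂ A₃) (∠ A₁ A₃ A₂)) with h | h
    · exact Or.inl h
    · rw [h]; exact Or.inr (max_choice _ _)
  clear hθM
  rcases hcase with rfl | rfl | rfl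
  · exact m1.trans (mul_le_mul_of_nonneg_left (by linarith) (Real.sqrt_nonneg _))
  · exact m2.trans (mul_le_mul_of_nonneg_left (by linarith) (Real.sqrt_nonneg _))
  · exact m3.trans (mul_le_mul_of_nonneg_left (by linarith) (Real.sqrt_nonneg _))
end

section
/- Let T be a triangle in the Euclidean plane ℝ² with a right angle at the vertex O, and let its two legs adjacent to the right angle have lengths ℓ₁ and ℓ₂ and unit direction vectors t₁ and t₂ (so t₁ ⊥ t₂). Let [y₁, y₂] be any segment contained in T, of length ℓ and with unit direction vector t. Then for every vector v ∈ ℝ²: √ℓ · |⟨v, t⟩| ≤ √ℓ₁ · |⟨v, t₁⟩| + √ℓ₂ · |⟨v, t₂⟩|. -/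
open MeasureTheory EuclideanGeometry Real
open scoped RealInnerProductSpace

lemma aux_coord (O P₁ P₂ y : EuclideanSpace ℝ (Fin 2))
    (h : y ∈ convexHull ℝ ({O, P₁, P₂} : Set (EuclideanSpace ℝ (Fin 2)))) :
    ∃ a b : ℝ, 0 ≤ a ∧ a ≤ 1 ∧ 0 ≤ b ∧ b ≤ 1 ∧ y = O + a • (P₁ - O) + b • (P₂ - O) := by
  rw [convexHull_insert (by simp), convexHull_pair, mem_convexJoin] at h
  obtain ⟨o, ho, z, ⟨c, d, hc, hd, hcd, rfl⟩, ⟨e, f, he, hf, hef, rfl⟩⟩ := h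
  rw [Set.mem_singleton_iff] at ho
  subst ho
  refine ⟨f * c, f * d, by positivity, by nlinarith, by positivity, by nlinarith, ?_⟩
  obtain rfl : c = 1 - d := by linarith
  obtain rfl : e = 1 - f := by linarith
  module

lemma aux_scal (a l L : ℝ) (ha : |a| ≤ 1) (hl : 0 < l) (hL : 0 < L) (h : |a| * l ≤ L) :
    √L * (L⁻¹ * |a|) ≤ √l * l⁻¹ := by
  have e : ∀ x : ℝ, 0 < x → √x * x⁻¹ = (√x)⁻¹ := by
    intro x hx
    have := Real.sq_sqrt hx.le
    have h0 := Real.sqrt_pos.2 hx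
    nth_rewrite 2 [← this]
    field_simp
  rw [← mul_assoc, e _ hL, e _ hl]
  have h1 := Real.sqrt_pos.2 hl
  have h2 := Real.sqrt_pos.2 hL
  have key : |a| * √l ≤ √L := by
    apply Real.le_sqrt_of_sq_le
    rw [mul_pow, Real.sq_sqrt hl.le]
    nlinarith [abs_nonneg a, mul_nonneg (abs_nonneg a) hl.le]
  rw [inv_mul_eq_div, ← one_div, div_le_div_iff₀ h2 h1]
  linarith

lemma aux_norm (u w : EuclideanSpace ℝ (Fin 2)) (a b : ℝ) (h : ⟪u, w⟫ = 0) :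
    |a| * ‖u‖ ≤ ‖a • u + b • w‖ := by
  have h' : ⟪a • u, b • w⟫ = 0 := by
    rw [real_inner_smul_left, real_inner_smul_right, h]; simp
  have := norm_add_sq_eq_norm_sq_add_norm_sq_of_inner_eq_zero _ _ h'
  rw [← Real.norm_eq_abs, ← norm_smul]
  refine (sq_le_sq₀ (norm_nonneg _) (norm_nonneg _)).1 ?_
  nlinarith [norm_nonneg (b • w)]

/-- right-angle case of Lemma C.3. Let `T` be the triangle with a
right angle at `O` and legs `[O, P₁]`, `[O, P₂]` of lengths `ℓ₁ = dist O P₁`,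
`ℓ₂ = dist O P₂` and unit directions `tᵢ = (Pᵢ − O)/‖Pᵢ − O‖`.  For any segment
`[y₁, y₂] ⊆ T` of positive length with unit direction `t = (y₂ − y₁)/‖y₂ − y₁‖`,
and every `v ∈ ℝ²`:
`√ℓ·|⟨v,t⟩| ≤ √ℓ₁·|⟨v,t₁⟩| + √ℓ₂·|⟨v,t₂⟩|`. -/
theorem stmt6 (O P₁ P₂ : EuclideanSpace ℝ (Fin 2))
    (h₁ : P₁ ≠ O) (h₂ : P₂ ≠ O)
    (hperp : ⟪P₁ - O, P₂ - O⟫ = 0)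
    (y₁ y₂ : EuclideanSpace ℝ (Fin 2)) (hy : y₁ ≠ y₂)
    (hseg : segment ℝ y₁ y₂ ⊆ convexHull ℝ ({O, P₁, P₂} : Set (EuclideanSpace ℝ (Fin 2))))
    (v : EuclideanSpace ℝ (Fin 2)) :
    Real.sqrt (dist y₁ y₂) * |⟪v, ‖y₂ - y₁‖⁻¹ • (y₂ - y₁)⟫| ≤
      Real.sqrt (dist O P₁) * |⟪v, ‖P₁ - O‖⁻¹ • (P₁ - O)⟫| +
      Real.sqrt (dist O P₂) * |⟪v, ‖P₂ - O‖⁻¹ • (P₂ - O)⟫| := by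
  obtain ⟨a₁, b₁, ha₁, ha₁', hb₁, hb₁', e₁⟩ := aux_coord _ _ _ _ (hseg (left_mem_segment ℝ y₁ y₂))
  obtain ⟨a₂, b₂, ha₂, ha₂', hb₂, hb₂', e₂⟩ := aux_coord _ _ _ _ (hseg (right_mem_segment ℝ y₁ y₂))
  have hw : y₂ - y₁ = (a₂ - a₁) • (P₁ - O) + (b₂ - b₁) • (P₂ - O) := by
    rw [e₁, e₂]; module
  have hL : 0 < ‖y₂ - y₁‖ := norm_pos_iff.2 (sub_ne_zero.2 hy.symm)
  have hl₁ : 0 < ‖P₁ - O‖ := norm_pos_iff.2 (sub_ne_zero.2 h₁)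
  have hl₂ : 0 < ‖P₂ - O‖ := norm_pos_iff.2 (sub_ne_zero.2 h₂)
  have n₁ := aux_norm _ _ (a₂ - a₁) (b₂ - b₁) hperp
  have n₂ := aux_norm _ _ (b₂ - b₁) (a₂ - a₁) ((real_inner_comm _ _).trans hperp)
  rw [← hw] at n₁
  rw [add_comm, ← hw] at n₂
  have s₁ := aux_scal _ _ _ (abs_le.2 ⟨by linarith, by linarith⟩) hl₁ hL n₁
  have s₂ := aux_scal _ _ _ (abs_le.2 ⟨by linarith, by linarith⟩) hl₂ hL n₂
  rw [dist_comm y₁, dist_comm O, dist_comm O, dist_eq_norm, dist_eq_norm, dist_eq_norm]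
  simp only [real_inner_smul_right, abs_mul, abs_inv, abs_norm]
  have t : |⟪v, y₂ - y₁⟫| ≤ |a₂ - a₁| * |⟪v, P₁ - O⟫| + |b₂ - b₁| * |⟪v, P₂ - O⟫| := by
    rw [hw, inner_add_right, real_inner_smul_right, real_inner_smul_right, ← abs_mul, ← abs_mul]
    exact abs_add_le _ _
  have m₁ := mul_le_mul_of_nonneg_right s₁ (abs_nonneg ⟪v, P₁ - O⟫)
  have m₂ := mul_le_mul_of_nonneg_right s₂ (abs_nonneg ⟪v, P₂ - O⟫)
  have m : 0 ≤ √‖y₂ - y₁‖ * ‖y₂ - y₁‖⁻¹ := by positivity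
  have := mul_le_mul_of_nonneg_left t m
  linarith
end

section
/- Let F ⊆ ℝ² be a bounded measurable set, let L > 0, and let l : F → ℝ be a measurable function with 0 ≤ l(x) ≤ L for all x ∈ F. Define the region P = {(x₁, x₂, ξ) ∈ ℝ³ : (x₁, x₂) ∈ F, 0 ≤ ξ ≤ l(x₁, x₂)}. Then for every continuously differentiable function u : ℝ³ → ℝ: ∫_P u² dV ≤ 2L · ∫_F u(x₁, x₂, 0)² dA + 2L² · ∫_P (∂u/∂ξ)² dV, where ∂u/∂ξ denotes the partial derivative of u in the third coordinate direction. -/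
open MeasureTheory

theorem aux_1d (L a : ℝ) (ha : 0 ≤ a) (haL : a ≤ L) (f : ℝ → ℝ) (hf : ContDiff ℝ 1 f) :
    (∫ t in (0:ℝ)..a, (f t) ^ 2) ≤ 2 * L * (f 0) ^ 2 + 2 * L ^ 2 * ∫ t in (0:ℝ)..a, (deriv f t) ^ 2 := by
  have hc : Continuous (deriv f) := hf.continuous_deriv le_rfl
  have hfc : Continuous f := hf.continuous
  set D := ∫ t in (0:ℝ)..a, (deriv f t) ^ 2 with hD
  have hD0 : 0 ≤ D := intervalIntegral.integral_nonneg ha (fun t _ => sq_nonneg _)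
  have hL : 0 ≤ L := ha.trans haL
  have key : ∀ t ∈ Set.Icc (0:ℝ) a, (f t) ^ 2 ≤ 2 * (f 0) ^ 2 + 2 * L * D := by
    intro t ht
    have hI : (∫ s in (0:ℝ)..t, deriv f s) = f t - f 0 :=
      intervalIntegral.integral_deriv_eq_sub
        (fun x _ => (hf.differentiable one_ne_zero) x) (hc.intervalIntegrable _ _)
    set I := f t - f 0 with hIdef
    set E := ∫ s in (0:ℝ)..t, (deriv f s) ^ 2 with hE
    have hED : E ≤ D := by
      have h1 : E + (∫ s in t..a, (deriv f s) ^ 2) = D :=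
        intervalIntegral.integral_add_adjacent_intervals
          ((hc.pow 2).intervalIntegrable _ _) ((hc.pow 2).intervalIntegrable _ _)
      have h2 : 0 ≤ ∫ s in t..a, (deriv f s) ^ 2 :=
        intervalIntegral.integral_nonneg ht.2 (fun t _ => sq_nonneg _)
      linarith
    have hE0 : 0 ≤ E := intervalIntegral.integral_nonneg ht.1 (fun t _ => sq_nonneg _)
    have hcs : I ^ 2 ≤ t * E := by
      rcases ht.1.eq_or_lt with h0 | h0
      · have : I = 0 := by rw [hIdef, ← h0]; ring
        rw [this, ← h0]; simp
      · have h1 : 0 ≤ ∫ s in (0:ℝ)..t, (t * deriv f s - I) ^ 2 :=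
          intervalIntegral.integral_nonneg ht.1 (fun t _ => sq_nonneg _)
        have h2 : (∫ s in (0:ℝ)..t, (t * deriv f s - I) ^ 2)
            = t ^ 2 * E - 2 * t * I * I + t * I ^ 2 := by
          have : ∀ s, (t * deriv f s - I) ^ 2
            = (t ^ 2 * (deriv f s) ^ 2 - 2 * t * I * deriv f s) + I ^ 2 := fun s => by ring
          simp_rw [this]
          rw [intervalIntegral.integral_add, intervalIntegral.integral_sub,
            intervalIntegral.integral_const_mul, intervalIntegral.integral_const_mul,
            intervalIntegral.integral_const, hI]
          · simp [hE]
          all_goals exact Continuous.intervalIntegrable (by fun_prop) _ _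
        have h3 : 0 ≤ t * (t * E - I ^ 2) := by rw [h2] at h1; linarith
        have := nonneg_of_mul_nonneg_right h3 h0
        linarith
    have h4 : t * E ≤ L * D := mul_le_mul (ht.2.trans haL) hED hE0 hL
    have h5 : f t = f 0 + I := by rw [hIdef]; ring
    rw [h5]
    nlinarith [sq_nonneg (f 0 - I)]
  have h := intervalIntegral.integral_mono_on ha ((hfc.pow 2).intervalIntegrable _ _)
    (continuous_const.intervalIntegrable (μ := volume) 0 a) key
  rw [intervalIntegral.integral_const] at h
  simp only [sub_zero, smul_eq_mul] at h
  have : a * (2 * (f 0) ^ 2 + 2 * L * D) ≤ L * (2 * (f 0) ^ 2 + 2 * L * D) :=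
    mul_le_mul_of_nonneg_right haL (by positivity)
  calc _ ≤ _ := h
    _ ≤ _ := this
    _ = _ := by ring

theorem aux_fub (F : Set (ℝ × ℝ)) (hFm : MeasurableSet F) (hFb : Bornology.IsBounded F)
    (L : ℝ) (l : ℝ × ℝ → ℝ) (hl : Measurable l)
    (hl0 : ∀ x ∈ F, 0 ≤ l x) (hlL : ∀ x ∈ F, l x ≤ L)
    (g : ℝ × ℝ × ℝ → ℝ) (hg : Continuous g) :
    IntegrableOn (fun x : ℝ × ℝ => ∫ t in (0:ℝ)..l x, g (x.1, x.2, t)) F ∧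
    (∫ q in {q : ℝ × ℝ × ℝ | (q.1, q.2.1) ∈ F ∧ 0 ≤ q.2.2 ∧ q.2.2 ≤ l (q.1, q.2.1)}, g q)
      = ∫ x in F, ∫ t in (0:ℝ)..l x, g (x.1, x.2, t) := by
  set P := {q : ℝ × ℝ × ℝ | (q.1, q.2.1) ∈ F ∧ 0 ≤ q.2.2 ∧ q.2.2 ≤ l (q.1, q.2.1)} with hP
  set Q := {p : (ℝ × ℝ) × ℝ | p.1 ∈ F ∧ 0 ≤ p.2 ∧ p.2 ≤ l p.1} with hQ
  set h : (ℝ × ℝ) × ℝ → ℝ := fun p => g (p.1.1, p.1.2, p.2) with hh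
  have hhc : Continuous h := by fun_prop
  have hQm : MeasurableSet Q :=
    (measurable_fst hFm).inter ((measurableSet_le measurable_const measurable_snd).inter
      (measurableSet_le measurable_snd (hl.comp measurable_fst)))
  have hint : IntegrableOn h Q := by
    have hK : IsCompact (closure F ×ˢ Set.Icc (0:ℝ) L) :=
      hFb.isCompact_closure.prod isCompact_Icc
    refine (hhc.continuousOn.integrableOn_compact hK).mono_set ?_
    rintro p ⟨h1, h2, h3⟩
    exact ⟨subset_closure h1, h2, h3.trans (hlL _ h1)⟩
  have hind : Integrable (Q.indicator h) (volume.prod volume) :=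
    (integrable_indicator_iff hQm).2 hint
  have hin : (fun x => ∫ t, Q.indicator h (x, t))
      = F.indicator (fun x : ℝ × ℝ => ∫ t in (0:ℝ)..l x, g (x.1, x.2, t)) := by
    funext x
    by_cases hx : x ∈ F
    · rw [Set.indicator_of_mem hx, intervalIntegral.integral_of_le (hl0 x hx),
        ← integral_Icc_eq_integral_Ioc, ← integral_indicator measurableSet_Icc]
      congr 1
      funext t
      by_cases ht : t ∈ Set.Icc 0 (l x)
      · have hq : (x, t) ∈ Q := ⟨hx, ht.1, ht.2⟩
        rw [Set.indicator_of_mem hq, Set.indicator_of_mem ht]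
      · have hq : (x, t) ∉ Q := fun hq => ht ⟨hq.2.1, hq.2.2⟩
        rw [Set.indicator_of_notMem hq, Set.indicator_of_notMem ht]
    · rw [Set.indicator_of_notMem hx]
      simp [Set.indicator_apply, hQ, hx]
  constructor
  · have := hind.integral_prod_left
    rw [hin] at this
    exact (integrable_indicator_iff hFm).1 this
  · have e1 := (volume_preserving_prodAssoc (α₁ := ℝ) (β₁ := ℝ) (γ₁ := ℝ)).setIntegral_preimage_emb
      MeasurableEquiv.prodAssoc.measurableEmbedding g P
    rw [← e1]
    change ∫ p in Q, h p = _
    rw [← integral_indicator hQm, Measure.volume_eq_prod, integral_prod _ hind, hin,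
      integral_indicator hFm]

/-- anisotropic Poincaré inequality, Lemma D.1. Let `F ⊆ ℝ²` be a
bounded measurable set, `L > 0`, and `l` a measurable height function with
`0 ≤ l ≤ L` on `F`.  Let `P = {(x₁,x₂,ξ) : (x₁,x₂) ∈ F, 0 ≤ ξ ≤ l(x₁,x₂)} ⊆ ℝ³`.
Then for every `C¹` function `u : ℝ³ → ℝ`:
`∫_P u² ≤ 2L·∫_F u(x₁,x₂,0)² + 2L²·∫_P (∂u/∂ξ)²`. -/
theorem stmt7 (F : Set (ℝ × ℝ)) (hFm : MeasurableSet F) (hFb : Bornology.IsBounded F)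
    (L : ℝ) (hL : 0 < L) (l : ℝ × ℝ → ℝ) (hl : Measurable l)
    (hl0 : ∀ x ∈ F, 0 ≤ l x) (hlL : ∀ x ∈ F, l x ≤ L)
    (u : ℝ × ℝ × ℝ → ℝ) (hu : ContDiff ℝ 1 u) :
    (∫ q in {q : ℝ × ℝ × ℝ | (q.1, q.2.1) ∈ F ∧ 0 ≤ q.2.2 ∧ q.2.2 ≤ l (q.1, q.2.1)},
        (u q) ^ 2) ≤
      2 * L * (∫ x in F, (u (x.1, x.2, 0)) ^ 2) +
      2 * L ^ 2 *
        ∫ q in {q : ℝ × ℝ × ℝ | (q.1, q.2.1) ∈ F ∧ 0 ≤ q.2.2 ∧ q.2.2 ≤ l (q.1, q.2.1)},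
          (deriv (fun t => u (q.1, q.2.1, t)) q.2.2) ^ 2 := by
  have hd : ∀ x y t : ℝ, deriv (fun t => u (x, y, t)) t = fderiv ℝ u (x, y, t) (0, 0, 1) := by
    intro x y t
    have h1 : HasDerivAt (fun t : ℝ => (x, y, t)) ((0:ℝ), (0:ℝ), (1:ℝ)) t :=
      (hasDerivAt_const t x).prodMk ((hasDerivAt_const t y).prodMk (hasDerivAt_id t))
    exact (((hu.differentiable one_ne_zero) (x, y, t)).hasFDerivAt.comp_hasDerivAt t h1).deriv
  have hdc : Continuous (fun q : ℝ × ℝ × ℝ =>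
      (deriv (fun t => u (q.1, q.2.1, t)) q.2.2) ^ 2) := by
    simp_rw [hd]
    have := hu.continuous_fderiv one_ne_zero
    fun_prop
  have huc : Continuous u := hu.continuous
  obtain ⟨i1, e1⟩ := aux_fub F hFm hFb L l hl hl0 hlL (fun q => (u q) ^ 2) (huc.pow 2)
  obtain ⟨i2, e2⟩ := aux_fub F hFm hFb L l hl hl0 hlL _ hdc
  have i3 : IntegrableOn (fun x : ℝ × ℝ => (u (x.1, x.2, 0)) ^ 2) F := by
    have hc : Continuous (fun x : ℝ × ℝ => (u (x.1, x.2, 0)) ^ 2) := by fun_prop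
    exact (hc.continuousOn.integrableOn_compact hFb.isCompact_closure).mono_set subset_closure
  rw [e1, e2, ← integral_const_mul, ← integral_const_mul,
    ← integral_add (i3.const_mul _) (i2.const_mul _)]
  refine setIntegral_mono_on i1 ((i3.const_mul _).add (i2.const_mul _)) hFm ?_
  intro x hx
  exact aux_1d L (l x) (hl0 x hx) (hlL x hx) (fun t => u (x.1, x.2, t))
    (hu.comp (by fun_prop))
end
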